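/- With B = (D; ηI) ∈ ℝ^{3N×N} (the vertical concatenation of D and ηI) and R = (D; ηT) H⁻¹ Bᵀ ∈ ℝ^{3N×3N} (where (D; ηT) is the vertical concatenation of D and ηT), it holds that RᵀR = B H⁻¹ Bᵀ − (μ/β) · B H⁻¹ (2AᵀA − τ(AᵀA)²) H⁻¹ Bᵀ. -/

import Mathlib

open Matrix
noncomputable section

/-- `DᵀD + cI` is positive definite for `c > 0`. -/
theorem posDef_transpose_mul_self_add_smul_one {k n : Type*} [Fintype k] [Fintype n]
    [DecidableEq n] (D : Matrix k n ℝ) {c : ℝ} (hc : 0 < c) :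
    (Dᵀ * D + c • (1 : Matrix n n ℝ)).PosDef := by
  have hD : (Dᵀ * D).PosSemidef := by
    simpa only [conjTranspose_eq_transpose_of_trivial] using posSemidef_conjTranspose_mul_self D
  exact (PosDef.one.smul hc).posSemidef_add hD

/-- The Gram matrix of `(D; ηT)` with `T = I - τS`, `S` symmetric. -/
theorem transpose_fromRows_mul_fromRows_one_sub_smul {k n : Type*} [Fintype k] [Fintype n]
    [DecidableEq n] (D : Matrix k n ℝ) {S : Matrix n n ℝ} (hS : Sᵀ = S) (η τ : ℝ) :
    (fromRows D (η • (1 - τ • S)))ᵀ * fromRows D (η • (1 - τ • S)) =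
      (Dᵀ * D + η ^ 2 • (1 : Matrix n n ℝ)) - (η ^ 2 * τ) • ((2 : ℝ) • S - τ • (S * S)) := by
  rw [transpose_fromRows, fromCols_mul_fromRows]
  simp only [transpose_smul, transpose_sub, transpose_one, hS, Matrix.smul_mul, Matrix.mul_smul,
    Matrix.sub_mul, Matrix.mul_sub, Matrix.one_mul, Matrix.mul_one]
  module

/-- with `B = (D; ηI)` and `R = (D; ηT)H⁻¹Bᵀ`, it holds that
`RᵀR = BH⁻¹Bᵀ − (μ/β)·BH⁻¹(2AᵀA − τ(AᵀA)²)H⁻¹Bᵀ`. -/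
theorem RtR_identity {N m : ℕ} (hN : 0 < N) (hm : 0 < m)
    (D : Matrix (Fin N ⊕ Fin N) (Fin N) ℝ) (A : Matrix (Fin m) (Fin N) ℝ)
    (μ β τ : ℝ) (hμ : 0 < μ) (hβ : 0 < β) (hτ0 : 0 < τ)
    (η : ℝ) (hη : η = Real.sqrt (μ/(β*τ)))
    (H : Matrix (Fin N) (Fin N) ℝ)
    (hH : H = Dᵀ * D + η^2 • (1 : Matrix (Fin N) (Fin N) ℝ))
    (T : Matrix (Fin N) (Fin N) ℝ)
    (hT : T = (1 : Matrix (Fin N) (Fin N) ℝ) - τ • (Aᵀ * A))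
    (B : Matrix ((Fin N ⊕ Fin N) ⊕ Fin N) (Fin N) ℝ)
    (hB : B = Matrix.fromRows D (η • (1 : Matrix (Fin N) (Fin N) ℝ)))
    (R : Matrix ((Fin N ⊕ Fin N) ⊕ Fin N) ((Fin N ⊕ Fin N) ⊕ Fin N) ℝ)
    (hR : R = Matrix.fromRows D (η • T) * H⁻¹ * Bᵀ) :
    Rᵀ * R = B * H⁻¹ * Bᵀ
      - (μ/β) • (B * H⁻¹ * ((2 : ℝ) • (Aᵀ * A) - τ • ((Aᵀ * A) * (Aᵀ * A))) * H⁻¹ * Bᵀ) := by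
  have hη2 : η ^ 2 = μ / (β * τ) := by rw [hη, Real.sq_sqrt (by positivity)]
  have hHpos : H.PosDef := by
    rw [hH]
    exact posDef_transpose_mul_self_add_smul_one D (by rw [hη2]; positivity)
  have hHinv : H⁻¹ * H = 1 :=
    nonsing_inv_mul H ((isUnit_iff_isUnit_det H).mp hHpos.isUnit)
  have hHsymm : (H⁻¹)ᵀ = H⁻¹ := by
    rw [transpose_nonsing_inv, ← conjTranspose_eq_transpose_of_trivial, hHpos.isHermitian.eq]
  have hcoef : η ^ 2 * τ = μ / β := by
    rw [hη2]
    field_simp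
  have hgram : (fromRows D (η • T))ᵀ * fromRows D (η • T) =
      H - (μ / β) • ((2 : ℝ) • (Aᵀ * A) - τ • ((Aᵀ * A) * (Aᵀ * A))) := by
    rw [hT, hH, ← hcoef]
    exact transpose_fromRows_mul_fromRows_one_sub_smul D (by simp) η τ
  calc Rᵀ * R
      = B * H⁻¹ * ((fromRows D (η • T))ᵀ * fromRows D (η • T)) * H⁻¹ * Bᵀ := by
        rw [hR]
        simp only [transpose_mul, transpose_transpose, hHsymm, Matrix.mul_assoc]
    _ = _ := by
        rw [hgram, Matrix.mul_sub, Matrix.sub_mul, Matrix.sub_mul, Matrix.mul_assoc B H⁻¹ H,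
          hHinv, Matrix.mul_one]
        simp only [Matrix.mul_smul, Matrix.smul_mul]
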